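/- Let α be a type-B composition of n and let π ∈ H_α. Then the set {σ ∈ H_α(312) : Inv(σ) ⊆ Inv(π)} has a greatest element with respect to inclusion of inversion sets: there exists a (necessarily unique) σ₀ ∈ H_α(312) with Inv(σ₀) ⊆ Inv(π) such that Inv(σ) ⊆ Inv(σ₀) for every σ ∈ H_α(312) with Inv(σ) ⊆ Inv(π). -/

import Mathlib

namespace TypeB

/-- A sign-symmetric permutation of degree `n`: a bijection of `ℤ` with
`π(-i) = -π(i)` which fixes every integer of absolute value `> n`.
It restricts to a sign-symmetric permutation of `±[n]`. -/
structure SignedPerm (n : ℕ) where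
  perm : Equiv.Perm ℤ
  sign_symm : ∀ i : ℤ, perm (-i) = - perm i
  outside : ∀ i : ℤ, (n : ℤ) < |i| → perm i = i

/-- Symbols for type-B inversions: `neg i` is `[i]`, `pair i j` (with `i < j`)
is `(i,j)`, and `mixed i j` (with `i < j`) is `(−j, i)`. -/
inductive BInv (n : ℕ) : Type where
  | neg : ℕ → BInv n
  | pair : ℕ → ℕ → BInv n
  | mixed : ℕ → ℕ → BInv n
deriving DecidableEq

/-- `i⁺`: `i+1` if `i ≠ -1`, and `1` for `i = -1`. -/
def iplus (i : ℤ) : ℤ := if i = -1 then 1 else i + 1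

/-- The inversion set of a sign-symmetric permutation. -/
def Inv {n : ℕ} (π : SignedPerm n) : Set (BInv n) := fun t =>
  match t with
  | .neg i => 1 ≤ i ∧ i ≤ n ∧ π.perm (i : ℤ) < 0
  | .pair i j => 1 ≤ i ∧ i < j ∧ j ≤ n ∧ π.perm (j : ℤ) < π.perm (i : ℤ)
  | .mixed i j => 1 ≤ i ∧ i < j ∧ j ≤ n ∧ π.perm (i : ℤ) + π.perm (j : ℤ) < 0

/-- The cover-inversion set of a sign-symmetric permutation. -/
def Cov {n : ℕ} (π : SignedPerm n) : Set (BInv n) := fun t =>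
  match t with
  | .neg i => 1 ≤ i ∧ i ≤ n ∧ π.perm (i : ℤ) = -1
  | .pair i j => 1 ≤ i ∧ i < j ∧ j ≤ n ∧ π.perm (i : ℤ) = iplus (π.perm (j : ℤ))
  | .mixed i j => 1 ≤ i ∧ i < j ∧ j ≤ n ∧ π.perm (-(j : ℤ)) = iplus (π.perm (i : ℤ))

/-- The symbol `(−j, i)` in canonical form (it equals `(−i, j)`). -/
def mixedInv {n : ℕ} (i j : ℕ) : BInv n := .mixed (min i j) (max i j)

/-- A type-B composition of `n`: positive parts summing to `n`,
together with a split/join label. -/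
structure BComp (n : ℕ) where
  parts : List ℕ
  pos : ∀ a ∈ parts, 0 < a
  sum_eq : parts.sum = n
  isJoin : Bool

/-- The partial sum `p_i = α₁ + ⋯ + α_i`. -/
def pSum {n : ℕ} (α : BComp n) (i : ℕ) : ℕ := (α.parts.take i).sum

/-- The α-region of `a ∈ [n]`: the unique `i` with `p_{i-1} < a ≤ p_i`. -/
def region {n : ℕ} (α : BComp n) (a : ℕ) : ℕ :=
  ((Finset.range α.parts.length).filter (fun j => pSum α j < a)).card

/-- The first part `α₁` of a type-B composition. -/
def alpha1 {n : ℕ} (α : BComp n) : ℕ := α.parts.headI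

/-- Index of the block of `Part(α)` containing `x ∈ ±[n]`; two elements lie in
a common block of `Part(α)` iff their indices agree. -/
def blockIdx {n : ℕ} (α : BComp n) (x : ℤ) : ℤ :=
  if 0 < x then
    (if α.isJoin = true ∧ region α x.toNat = 1 then 0 else (region α x.toNat : ℤ))
  else
    (if α.isJoin = true ∧ region α (-x).toNat = 1 then 0 else -(region α (-x).toNat : ℤ))

/-- Membership in `±[n]`. -/
def inPM (n : ℕ) (x : ℤ) : Prop := x ≠ 0 ∧ -(n : ℤ) ≤ x ∧ x ≤ (n : ℤ)

/-- `π ∈ H_α`: `π` is increasing on every block of `Part(α)`. -/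
def memH {n : ℕ} (α : BComp n) (π : SignedPerm n) : Prop :=
  ∀ a b : ℤ, inPM n a → inPM n b → a < b → blockIdx α a = blockIdx α b →
    π.perm a < π.perm b

/-- Common part of the type-B `(α,231)`- and `(α,312)`-patterns: indices
`i < j < k` in `±[n]`, in pairwise distinct blocks of `Part(α)`, with `j > 0`
and `π(i) = π(k)⁺`. -/
def patternCore {n : ℕ} (α : BComp n) (π : SignedPerm n) (i j k : ℤ) : Prop :=
  inPM n i ∧ inPM n j ∧ inPM n k ∧ i < j ∧ j < k ∧ 0 < j ∧
  blockIdx α i ≠ blockIdx α j ∧ blockIdx α j ≠ blockIdx α k ∧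
  blockIdx α i ≠ blockIdx α k ∧ π.perm i = iplus (π.perm k)

/-- `π` has a type-B `(α,231)`-split (resp. -join) pattern, according to the
label of `α`. -/
def has231 {n : ℕ} (α : BComp n) (π : SignedPerm n) : Prop :=
  ∃ i j k : ℤ, patternCore α π i j k ∧
    (if α.isJoin = true then
       (((alpha1 α : ℤ) < j → π.perm i < π.perm j) ∧
        (j ≤ (alpha1 α : ℤ) → π.perm j < π.perm k))
     else π.perm i < π.perm j)

/-- `π` has a type-B `(α,312)`-split (resp. -join) pattern, according to the
label of `α`. -/
def has312 {n : ℕ} (α : BComp n) (π : SignedPerm n) : Prop :=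
  ∃ i j k : ℤ, patternCore α π i j k ∧
    (if α.isJoin = true then
       (((alpha1 α : ℤ) < j → π.perm j < π.perm k) ∧
        (j ≤ (alpha1 α : ℤ) → π.perm i < π.perm j))
     else π.perm j < π.perm k)

/-- `π ∈ H_α(231)`. -/
def mem231 {n : ℕ} (α : BComp n) (π : SignedPerm n) : Prop := memH α π ∧ ¬ has231 α π

/-- `π ∈ H_α(312)`. -/
def mem312 {n : ℕ} (α : BComp n) (π : SignedPerm n) : Prop := memH α π ∧ ¬ has312 α π

/-- The set `H_α`. -/
def Hset {n : ℕ} (α : BComp n) : Set (SignedPerm n) := {π | memH α π}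

/-- The carrier of `Tam_B(α)`, namely `H_α(231)`. -/
def Tset {n : ℕ} (α : BComp n) : Set (SignedPerm n) := {π | mem231 α π}

/-- The weak order: inclusion of inversion sets. -/
def wle {n : ℕ} (π σ : SignedPerm n) : Prop := Inv π ⊆ Inv σ

/-- `m` is the greatest lower bound of `x` and `y` within `P`, w.r.t. the weak order. -/
def isMeetIn {n : ℕ} (P : Set (SignedPerm n)) (x y m : SignedPerm n) : Prop :=
  m ∈ P ∧ wle m x ∧ wle m y ∧ ∀ z ∈ P, wle z x → wle z y → wle z m

/-- `u` is the least upper bound of `x` and `y` within `P`, w.r.t. the weak order. -/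
def isJoinIn {n : ℕ} (P : Set (SignedPerm n)) (x y u : SignedPerm n) : Prop :=
  u ∈ P ∧ wle x u ∧ wle y u ∧ ∀ z ∈ P, wle x z → wle y z → wle u z

/-- `d = Π↓(π)`: `d` is the greatest element of `{σ ∈ H_α(231) : Inv σ ⊆ Inv π}`. -/
def isProjDown {n : ℕ} (α : BComp n) (π d : SignedPerm n) : Prop :=
  mem231 α d ∧ wle d π ∧ ∀ σ, mem231 α σ → wle σ π → wle σ d

/-- `d = Π†(π)`: `d` is the greatest element of `{σ ∈ H_α(312) : Inv σ ⊆ Inv π}`. -/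
def isProjDagger {n : ℕ} (α : BComp n) (π d : SignedPerm n) : Prop :=
  mem312 α d ∧ wle d π ∧ ∀ σ, mem312 α σ → wle σ π → wle σ d

/-- The value `ω_{o;α}(a)` for `a ∈ [n]`. -/
def omegaPos {n : ℕ} (α : BComp n) (a : ℕ) : ℤ :=
  if α.isJoin = true ∧ region α a = 1 then (a : ℤ)
  else -(((pSum α (region α a) : ℤ) + (pSum α (region α a - 1) : ℤ) + 1) - (a : ℤ))

/-- The longest element `ω_{o;α}` of `H_α`, as a function on `ℤ`. -/
def omegaFun {n : ℕ} (α : BComp n) (x : ℤ) : ℤ :=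
  if 0 < x ∧ x ≤ (n : ℤ) then omegaPos α x.toNat
  else if 0 < -x ∧ -x ≤ (n : ℤ) then -(omegaPos α (-x).toNat)
  else x

/-- The set of `m` such that there is a strict chain `x₀ < x₁ < ⋯ < x_m` in `P`. -/
def chainLengths {n : ℕ} (P : Set (SignedPerm n)) : Set ℕ :=
  {m | ∃ f : Fin (m + 1) → SignedPerm n, (∀ i, f i ∈ P) ∧
        ∀ i j : Fin (m + 1), i < j → Inv (f i) ⊂ Inv (f j)}

/-- `x` is join-irreducible in `Tam_B(α)`. -/
def joinIrred {n : ℕ} (α : BComp n) (x : SignedPerm n) : Prop :=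
  x ∈ Tset α ∧ ¬ (∀ y ∈ Tset α, wle x y) ∧
  ∀ y z, y ∈ Tset α → z ∈ Tset α → isJoinIn (Tset α) y z x → x = y ∨ x = z

/-- `x` is meet-irreducible in `Tam_B(α)`. -/
def meetIrred {n : ℕ} (α : BComp n) (x : SignedPerm n) : Prop :=
  x ∈ Tset α ∧ ¬ (∀ y ∈ Tset α, wle y x) ∧
  ∀ y z, y ∈ Tset α → z ∈ Tset α → isMeetIn (Tset α) y z x → x = y ∨ x = z

/-- `x` is left modular in the lattice on `P`: `(r ∨ x) ∧ q = r ∨ (x ∧ q)`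
for all `r ≤ q` in `P`. -/
def leftModular {n : ℕ} (P : Set (SignedPerm n)) (x : SignedPerm n) : Prop :=
  ∀ r q, r ∈ P → q ∈ P → wle r q →
    ∀ u v w1 w2, isJoinIn P r x u → isMeetIn P u q v →
      isMeetIn P x q w1 → isJoinIn P r w1 w2 → v = w2

/-- The simple generator `s_i` as a function on `ℤ`: `s₀` exchanges `1` and `-1`,
and for `i ≥ 1`, `s_i` exchanges `i` with `i+1` and `-i` with `-(i+1)`. -/
def sfun (i : ℕ) (x : ℤ) : ℤ :=
  if i = 0 then (if x = 1 then -1 else if x = -1 then 1 else x)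
  else if x = (i : ℤ) then (i : ℤ) + 1
  else if x = (i : ℤ) + 1 then (i : ℤ)
  else if x = -(i : ℤ) then -(i : ℤ) - 1
  else if x = -(i : ℤ) - 1 then -(i : ℤ)
  else x

/-- `i` is one of the partial sums `p₁, …, p_{r−1}` of `α`. -/
def isPSum {n : ℕ} (α : BComp n) (i : ℕ) : Prop :=
  ∃ j : ℕ, 1 ≤ j ∧ j < α.parts.length ∧ pSum α j = i

/-- `n² − Σᵢ α_i(α_i−1)/2`, minus additionally `(α₁+1)α₁/2` when `α` is join. -/
def lengthFormula {n : ℕ} (α : BComp n) : ℕ :=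
  n ^ 2 - (α.parts.map (fun a => a * (a - 1) / 2)).sum -
    (if α.isJoin = true then (alpha1 α + 1) * alpha1 α / 2 else 0)

namespace SignedPerm

variable {n : ℕ}

theorem perm_zero (π : SignedPerm n) : π.perm 0 = 0 := by
  have h := π.sign_symm 0
  rw [neg_zero] at h
  omega

theorem perm_eq_self_of_lt_abs_perm (π : SignedPerm n) {x : ℤ} (h : (n : ℤ) < |π.perm x|) :
    π.perm x = x :=
  π.perm.injective (π.outside _ h)

theorem inPM_iff_abs {x : ℤ} : inPM n x ↔ x ≠ 0 ∧ |x| ≤ n := by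
  unfold inPM
  rw [abs_le]

theorem inPM_perm_iff (π : SignedPerm n) {x : ℤ} : inPM n (π.perm x) ↔ inPM n x := by
  have h0 : π.perm x = 0 ↔ x = 0 := by
    rw [← π.perm.injective.eq_iff (a := x), π.perm_zero]
  rw [inPM_iff_abs, inPM_iff_abs, Ne, h0]
  refine and_congr_right fun _ => not_iff_not.mp ?_
  rw [not_le, not_le]
  constructor <;> intro h
  · rwa [π.perm_eq_self_of_lt_abs_perm h] at h
  · rwa [π.outside x h]

theorem abs_le_of_inversion (π : SignedPerm n) {a b : ℤ} (hab : a < b)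
    (h : π.perm b < π.perm a) : |a| ≤ n ∧ |b| ≤ n := by
  have key : ∀ x, ((n : ℤ) < |x| ∧ π.perm x = x) ∨ (|x| ≤ n ∧ |π.perm x| ≤ n) := by
    intro x
    rcases lt_or_ge (n : ℤ) |x| with hx | hx
    · exact .inl ⟨hx, π.outside x hx⟩
    · refine .inr ⟨hx, ?_⟩
      by_contra! hc
      rw [π.perm_eq_self_of_lt_abs_perm hc] at hc
      omega
  have ha := key a
  have hb := key b
  simp only [abs_le, lt_abs] at *
  omega

theorem wle_of_forall_inPM {π σ : SignedPerm n}
    (h : ∀ a b : ℤ, inPM n a → inPM n b → a < b → π.perm b < π.perm a → σ.perm b < σ.perm a) :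
    wle π σ := by
  have hmem : ∀ {x : ℤ}, x ≠ 0 → -(n : ℤ) ≤ x → x ≤ n → inPM n x := fun h1 h2 h3 => ⟨h1, h2, h3⟩
  intro t ht
  match t, ht with
  | .neg i, ⟨h1, h2, h3⟩ =>
    refine ⟨h1, h2, ?_⟩
    have := h (-i) i (hmem (by omega) (by omega) (by omega)) (hmem (by omega) (by omega) (by omega))
      (by omega) (by rw [π.sign_symm]; omega)
    rw [σ.sign_symm] at this
    omega
  | .pair i j, ⟨h1, h2, h3, h4⟩ =>
    exact ⟨h1, h2, h3, h i j (hmem (by omega) (by omega) (by omega))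
      (hmem (by omega) (by omega) (by omega)) (by omega) h4⟩
  | .mixed i j, ⟨h1, h2, h3, h4⟩ =>
    refine ⟨h1, h2, h3, ?_⟩
    have := h (-i) j (hmem (by omega) (by omega) (by omega))
      (hmem (by omega) (by omega) (by omega)) (by omega) (by rw [π.sign_symm]; omega)
    rw [σ.sign_symm] at this
    omega

theorem wle_iff {π σ : SignedPerm n} :
    wle π σ ↔ ∀ a b : ℤ, a < b → π.perm b < π.perm a → σ.perm b < σ.perm a := by
  constructor
  · intro h a b hab hinv
    obtain ⟨ha, hb⟩ := π.abs_le_of_inversion hab hinv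
    rw [abs_le] at ha hb
    have hneg : ∀ c : ℕ, 1 ≤ c → c ≤ n → π.perm c < 0 → σ.perm c < 0 := fun c h1 h2 h3 =>
      (h (show BInv.neg c ∈ Inv π from ⟨h1, h2, h3⟩)).2.2
    have hpair : ∀ c d : ℕ, 1 ≤ c → c < d → d ≤ n → π.perm d < π.perm c →
        σ.perm d < σ.perm c := fun c d h1 h2 h3 h4 =>
      (h (show BInv.pair c d ∈ Inv π from ⟨h1, h2, h3, h4⟩)).2.2.2
    have hmixed : ∀ c d : ℕ, 1 ≤ c → c < d → d ≤ n → π.perm c + π.perm d < 0 →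
        σ.perm c + σ.perm d < 0 := fun c d h1 h2 h3 h4 =>
      (h (show BInv.mixed c d ∈ Inv π from ⟨h1, h2, h3, h4⟩)).2.2.2
    have hπ0 := π.perm_zero
    have hσ0 := σ.perm_zero
    have hπa := π.sign_symm a
    have hσa := σ.sign_symm a
    have hπb := π.sign_symm b
    have hσb := σ.sign_symm b
    rcases lt_trichotomy a 0 with ha0 | rfl | ha0
    · obtain ⟨a', ha'⟩ := Int.eq_ofNat_of_zero_le (show 0 ≤ -a by omega)
      rw [ha'] at hπa hσa
      rcases lt_trichotomy b 0 with hb0 | rfl | hb0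
      · obtain ⟨b', hb'⟩ := Int.eq_ofNat_of_zero_le (show 0 ≤ -b by omega)
        rw [hb'] at hπb hσb
        have := hpair b' a' (by omega) (by omega) (by omega) (by omega)
        omega
      · have := hneg a' (by omega) (by omega) (by omega)
        omega
      · obtain ⟨b', rfl⟩ := Int.eq_ofNat_of_zero_le hb0.le
        rcases lt_trichotomy a' b' with hlt | rfl | hlt
        · have := hmixed a' b' (by omega) hlt (by omega) (by omega)
          omega
        · have := hneg a' (by omega) (by omega) (by omega)
          omega
        · have := hmixed b' a' (by omega) hlt (by omega) (by omega)
          omega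
    · obtain ⟨b', rfl⟩ := Int.eq_ofNat_of_zero_le hab.le
      have := hneg b' (by omega) (by omega) (by omega)
      omega
    · obtain ⟨a', rfl⟩ := Int.eq_ofNat_of_zero_le ha0.le
      obtain ⟨b', rfl⟩ := Int.eq_ofNat_of_zero_le (ha0.trans hab).le
      exact hpair a' b' (by omega) (by omega) (by omega) hinv
  · exact fun h => wle_of_forall_inPM fun a b _ _ => h a b

theorem wle_antisymm {π σ : SignedPerm n} (h₁ : wle π σ) (h₂ : wle σ π) : π = σ := by
  rw [wle_iff] at h₁ h₂
  have hlt : ∀ a b : ℤ, π.perm a < π.perm b → σ.perm a < σ.perm b := by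
    intro a b h
    rcases lt_trichotomy a b with hab | rfl | hab
    · by_contra! hc
      have hne : σ.perm b ≠ σ.perm a := fun e => hab.ne' (σ.perm.injective e)
      exact h.not_gt (h₂ a b hab (lt_of_le_of_ne hc hne))
    · exact absurd h (lt_irrefl _)
    · exact h₁ b a hab h
  set f : ℤ → ℤ := fun x => σ.perm (π.perm.symm x) with hf
  have hout : ∀ x : ℤ, (n : ℤ) < |x| → f x = x := by
    intro x hx
    have : π.perm.symm x = x := by rw [Equiv.symm_apply_eq, π.outside x hx]
    simp only [hf, this, σ.outside x hx]
  have hmono : Monotone fun x => f x - x := by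
    refine monotone_int_of_le_succ fun x => ?_
    have : f x < f (x + 1) := hlt _ _ (by simp)
    omega
  have hid : ∀ x, f x = x := by
    intro x
    have hu := hmono (show x ≤ max x (n + 1) from le_max_left _ _)
    have hl := hmono (show min x (-(n + 1)) ≤ x from min_le_left _ _)
    have e1 := hout (max x (n + 1)) (by rw [lt_abs]; omega)
    have e2 := hout (min x (-(n + 1))) (by rw [lt_abs]; omega)
    simp only at hu hl
    omega
  have hperm : π.perm = σ.perm := by
    ext x
    simpa [hf] using (hid (π.perm x)).symm
  cases π
  cases σ
  cases hperm
  rfl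

end SignedPerm

section Blocks

variable {n : ℕ} (α : BComp n)

theorem region_mono {a b : ℕ} (h : a ≤ b) : region α a ≤ region α b :=
  Finset.card_le_card fun _ hj => by
    rw [Finset.mem_filter] at hj ⊢
    exact ⟨hj.1, hj.2.trans_le h⟩

theorem region_pos {a : ℕ} (h : 1 ≤ a) (han : a ≤ n) : 1 ≤ region α a := by
  refine Finset.card_pos.mpr ⟨0, ?_⟩
  rw [Finset.mem_filter, Finset.mem_range]
  refine ⟨List.length_pos_iff.mpr fun h0 => ?_, by simp [pSum]; omega⟩
  have := α.sum_eq
  simp [h0] at this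
  omega

theorem region_eq_one_iff {a : ℕ} (h : 1 ≤ a) (han : a ≤ n) :
    region α a = 1 ↔ a ≤ alpha1 α := by
  have hpos := region_pos α h han
  have hsum := α.sum_eq
  unfold region at *
  unfold alpha1
  rcases hp : α.parts with _ | ⟨p, l⟩
  · simp [hp] at hsum
    omega
  · constructor
    · intro h1
      by_contra! hc
      rw [List.headI] at hc
      rw [hp, List.sum_cons] at hsum
      have hl : 1 ≤ l.length := by
        rcases l with _ | ⟨q, l⟩
        · simp at hsum
          omega
        · simp
      have hsub : ({0, 1} : Finset ℕ) ⊆ (Finset.range (p :: l).length).filter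
          (fun j => pSum α j < a) := by
        intro j hj
        rw [Finset.mem_insert, Finset.mem_singleton] at hj
        rw [Finset.mem_filter, Finset.mem_range, List.length_cons]
        rcases hj with rfl | rfl
        · exact ⟨by omega, by simp [pSum]; omega⟩
        · exact ⟨by omega, by simp [pSum, hp]; omega⟩
      have := Finset.card_le_card hsub
      rw [h1] at this
      simp at this
    · intro ha
      rw [List.headI] at ha
      refine le_antisymm ?_ (hp ▸ hpos)
      have hsub : (Finset.range (p :: l).length).filter (fun j => pSum α j < a) ⊆ {0} := by
        intro j hj
        rw [Finset.mem_filter] at hj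
        rw [Finset.mem_singleton]
        rcases j with _ | j
        · rfl
        · have := hj.2
          simp [pSum, hp] at this
          omega
      simpa using Finset.card_le_card hsub

theorem blockIdx_neg {x : ℤ} (hx : x ≠ 0) : blockIdx α (-x) = -blockIdx α x := by
  unfold blockIdx
  rcases lt_or_gt_of_ne hx with h | h
  · rw [if_pos (by omega : 0 < -x), if_neg (by omega : ¬ 0 < x)]
    split_ifs <;> simp
  · rw [if_neg (by omega : ¬ 0 < -x), if_pos h, neg_neg]
    split_ifs <;> simp

theorem blockIdx_nonneg {x : ℤ} (hx : 0 < x) : 0 ≤ blockIdx α x := by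
  unfold blockIdx
  rw [if_pos hx]
  split_ifs <;> simp

theorem blockIdx_eq_zero_iff {x : ℤ} (hx : inPM n x) (h0 : 0 < x) :
    blockIdx α x = 0 ↔ α.isJoin = true ∧ x ≤ alpha1 α := by
  obtain ⟨a, rfl⟩ := Int.eq_ofNat_of_zero_le h0.le
  have h1 : 1 ≤ a := by omega
  have h2 : a ≤ n := by have := hx.2.2; omega
  have := region_pos α h1 h2
  unfold blockIdx
  simp only [if_pos h0, Int.toNat_natCast, region_eq_one_iff α h1 h2, Nat.cast_le]
  split_ifs with h
  · simp [h]
  · simp only [h, iff_false]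
    omega

theorem blockIdx_mono {x y : ℤ} (hx : inPM n x) (hy : inPM n y) (hxy : x < y) :
    blockIdx α x ≤ blockIdx α y := by
  have hpos : ∀ x y : ℤ, 0 < x → y ≤ n → x < y → blockIdx α x ≤ blockIdx α y := by
    intro x y hx hy hxy
    have h1 := region_mono α (show x.toNat ≤ y.toNat by omega)
    have h2 := region_pos α (show 1 ≤ x.toNat by omega) (by omega)
    unfold blockIdx
    rw [if_pos hx, if_pos (hx.trans hxy)]
    split_ifs <;> grind
  rcases lt_or_gt_of_ne hy.1 with h | h
  · have := hpos (-y) (-x) (by omega) (by have := hx.2.1; omega) (by omega)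
    rw [blockIdx_neg α hx.1, blockIdx_neg α hy.1] at this
    omega
  · rcases lt_or_gt_of_ne hx.1 with h' | h'
    · have h1 := blockIdx_nonneg α (show 0 < -x by omega)
      have h2 := blockIdx_nonneg α h
      rw [blockIdx_neg α hx.1] at h1
      omega
    · exact hpos x y h' hy.2.2 hxy

theorem lt_of_blockIdx_lt {x y : ℤ} (hx : inPM n x) (hy : inPM n y)
    (h : blockIdx α x < blockIdx α y) : x < y := by
  by_contra! hc
  rcases hc.lt_or_eq with hc | rfl
  · exact h.not_ge (blockIdx_mono α hy hx hc)
  · exact h.false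

end Blocks

section Patterns

variable {n : ℕ} {α : BComp n}

theorem inPM.neg {x : ℤ} (h : inPM n x) : inPM n (-x) := by
  unfold inPM at *
  omega

theorem iplus_spec (v : ℤ) : (v = -1 ∧ iplus v = 1) ∨ (v ≠ -1 ∧ iplus v = v + 1) := by
  unfold iplus
  split_ifs with h <;> simp [h]

/-- A uniform description of `(α,312)`-patterns for split and join compositions: the positions
lie in blocks of strictly increasing index, the middle one is nonnegative, and the values form a
`312`-pattern whose two larger values are consecutive. -/
def IsPattern (α : BComp n) (π : SignedPerm n) (i j k : ℤ) : Prop :=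
  inPM n i ∧ inPM n j ∧ inPM n k ∧ blockIdx α i < blockIdx α j ∧ blockIdx α j < blockIdx α k ∧
    0 ≤ blockIdx α j ∧ π.perm i = iplus (π.perm k) ∧ π.perm j < π.perm k

theorem exists_isPattern_of_has312 {π : SignedPerm n} (h : has312 α π) :
    ∃ i j k, IsPattern α π i j k := by
  obtain ⟨i, j, k, ⟨hi, hj, hk, hij, hjk, hj0, bij, bjk, -, hval⟩, hpat⟩ := h
  have hbij := lt_of_le_of_ne (blockIdx_mono α hi hj hij) bij
  have hbjk := lt_of_le_of_ne (blockIdx_mono α hj hk hjk) bjk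
  have hnn := blockIdx_nonneg α hj0
  by_cases h0 : blockIdx α j = 0
  · obtain ⟨hJ, hle⟩ := (blockIdx_eq_zero_iff α hj hj0).mp h0
    rw [if_pos hJ] at hpat
    have hlt := hpat.2 hle
    refine ⟨-k, -j, -i, hk.neg, hj.neg, hi.neg, ?_⟩
    rw [blockIdx_neg α hi.1, blockIdx_neg α hj.1, blockIdx_neg α hk.1, π.sign_symm, π.sign_symm,
      π.sign_symm]
    have s1 := iplus_spec (π.perm k)
    have s2 := iplus_spec (-π.perm i)
    have hi0 := (π.inPM_perm_iff.mpr hi).1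
    have hk0 := (π.inPM_perm_iff.mpr hk).1
    omega
  · refine ⟨i, j, k, hi, hj, hk, hbij, hbjk, hnn, hval, ?_⟩
    rw [blockIdx_eq_zero_iff α hj hj0] at h0
    split_ifs at hpat with hJ
    · exact hpat.1 (by simpa [hJ] using h0)
    · exact hpat

theorem IsPattern.has312 {π : SignedPerm n} (hπ : memH α π) {i j k : ℤ}
    (h : IsPattern α π i j k) : has312 α π := by
  obtain ⟨hi, hj, hk, hij, hjk, hnn, hval, hlt⟩ := h
  by_cases h0 : blockIdx α j = 0
  · wlog hneg : j < 0 generalizing j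
    · have hb := blockIdx_neg α hj.1
      have hjpos : 0 < j := lt_of_le_of_ne (not_lt.mp hneg) hj.1.symm
      have hinc := hπ (-j) j hj.neg hj (by omega) (by omega)
      exact this hj.neg (by omega) (by omega) (by omega) (by omega) (by omega) (by omega)
    have hb := blockIdx_neg α hj.1
    obtain ⟨hJ, hle⟩ := (blockIdx_eq_zero_iff α hj.neg (by omega)).mp (by omega)
    have l1 := lt_of_blockIdx_lt α hi hj hij
    have l2 := lt_of_blockIdx_lt α hj hk hjk
    refine ⟨-k, -j, -i, ⟨hk.neg, hj.neg, hi.neg, by omega, by omega, by omega, ?_⟩, ?_⟩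
    · rw [blockIdx_neg α hi.1, blockIdx_neg α hj.1, blockIdx_neg α hk.1, π.sign_symm, π.sign_symm]
      have s1 := iplus_spec (π.perm k)
      have s2 := iplus_spec (-π.perm i)
      have hi0 := (π.inPM_perm_iff.mpr hi).1
      have hk0 := (π.inPM_perm_iff.mpr hk).1
      omega
    · rw [if_pos hJ, π.sign_symm j, π.sign_symm k]
      exact ⟨fun h => absurd h (not_lt.mpr hle), fun _ => by omega⟩
  · have hj0 : 0 < j := by
      by_contra! hc
      have hb := blockIdx_neg α hj.1
      have hj1 := hj.1
      have := blockIdx_nonneg α (show 0 < -j by omega)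
      omega
    refine ⟨i, j, k, ⟨hi, hj, hk, lt_of_blockIdx_lt α hi hj hij, lt_of_blockIdx_lt α hj hk hjk,
      hj0, hij.ne, hjk.ne, (hij.trans hjk).ne, hval⟩, ?_⟩
    rw [blockIdx_eq_zero_iff α hj hj0] at h0
    split_ifs with hJ
    · exact ⟨fun _ => hlt, fun hle => absurd ⟨hJ, hle⟩ h0⟩
    · exact hlt

/-- A `312`-avoider below `π` does not invert the outer positions of a pattern of `π`. -/
theorem IsPattern.not_inverted_of_wle {π σ : SignedPerm n} {i j k : ℤ}
    (h : IsPattern α π i j k) (hσ : mem312 α σ) (hle : wle σ π) : ¬ σ.perm k < σ.perm i := by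
  intro hki
  obtain ⟨hi, hj, hk, hij, hjk, hnn, hval, hlt⟩ := h
  rw [SignedPerm.wle_iff] at hle
  have hjk' : σ.perm j < σ.perm k := by
    by_contra! hc
    have hlt' := lt_of_blockIdx_lt α hj hk hjk
    have hne : σ.perm k ≠ σ.perm j := fun e => hlt'.ne' (σ.perm.injective e)
    exact hlt.not_gt (hle j k hlt' (lt_of_le_of_ne hc hne))
  -- no position whose value lies between those of `k` and `i` belongs to the block of `j`
  have havoid : ∀ x, inPM n x → σ.perm k ≤ σ.perm x → σ.perm x ≤ σ.perm i →
      blockIdx α x ≠ blockIdx α j := by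
    intro x hx h1 h2 he
    have hix := lt_of_blockIdx_lt α hi hx (he ▸ hij)
    have hxk := lt_of_blockIdx_lt α hx hk (he ▸ hjk)
    have hne1 : σ.perm k ≠ σ.perm x := fun e => hxk.ne' (σ.perm.injective e)
    have hne2 : σ.perm x ≠ σ.perm i := fun e => hix.ne' (σ.perm.injective e)
    have h3 := hle x k hxk (lt_of_le_of_ne h1 hne1)
    have h4 := hle i x hix (lt_of_le_of_ne h2 hne2)
    have hx0 := (π.inPM_perm_iff.mpr hx).1
    have := iplus_spec (π.perm k)
    omega
  have hk' := σ.inPM_perm_iff.mpr hk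
  have hi' := σ.inPM_perm_iff.mpr hi
  let pos : ℤ → ℤ := fun v => σ.perm.symm (if v = 0 then -1 else v)
  have hstep : ∃ v, σ.perm k ≤ v ∧ v < σ.perm i ∧ blockIdx α j < blockIdx α (pos v) ∧
      ¬ blockIdx α j < blockIdx α (pos (v + 1)) := by
    by_contra! hc
    have hall : ∀ v, σ.perm k ≤ v → v ≤ σ.perm i → blockIdx α j < blockIdx α (pos v) := by
      intro v hv
      induction v, hv using Int.leInduction with
      | base => intro _; simpa [pos, hk'.1] using hjk
      | succ v hv ih => exact fun h => hc v hv (by omega) (ih (by omega))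
    have := hall _ hki.le le_rfl
    simp only [pos, hi'.1, if_false, Equiv.symm_apply_apply] at this
    omega
  obtain ⟨v, hv1, hv2, hv3, hv4⟩ := hstep
  have hv5 : v ≠ -1 := by
    rintro rfl
    exact hv4 (by simpa [pos] using hv3)
  have hk0 := hk'.1
  unfold inPM at hk' hi'
  obtain ⟨w, hw, hw0, hwk⟩ : ∃ w, pos v = σ.perm.symm w ∧ iplus w = v + 1 ∧
      σ.perm k ≤ w ∧ w < σ.perm i ∧ w ≠ 0 := by
    have := iplus_spec v
    have := iplus_spec (-1)
    by_cases h0 : v = 0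
    · exact ⟨-1, by simp [pos, h0], by omega⟩
    · exact ⟨v, by simp [pos, h0], by omega⟩
  have hpos : pos (v + 1) = σ.perm.symm (v + 1) := by
    simp only [pos]
    rw [if_neg (by omega)]
  rw [hw] at hv3
  rw [hpos] at hv4
  have hx : inPM n (σ.perm.symm (v + 1)) := by
    rw [← σ.inPM_perm_iff, Equiv.apply_symm_apply]
    unfold inPM
    omega
  have hy : inPM n (σ.perm.symm w) := by
    rw [← σ.inPM_perm_iff, Equiv.apply_symm_apply]
    unfold inPM
    omega
  have hne := havoid _ hx (by rw [Equiv.apply_symm_apply]; omega)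
    (by rw [Equiv.apply_symm_apply]; omega)
  refine hσ.2 (IsPattern.has312 (i := σ.perm.symm (v + 1)) (j := j) (k := σ.perm.symm w) hσ.1
    ⟨hx, hj, hy, by omega, hv3, hnn, ?_, ?_⟩)
  · rw [Equiv.apply_symm_apply, Equiv.apply_symm_apply, hw0]
  · rw [Equiv.apply_symm_apply]
    omega

end Patterns

section Exchange

/-- The sign-symmetric map exchanging `v` with `v⁺` and `-v` with `-v⁺`. -/
def exchange (v x : ℤ) : ℤ :=
  if x = v then iplus v else if x = iplus v then v
  else if x = -v then -iplus v else if x = -iplus v then -v else x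

theorem exchange_involutive {v : ℤ} (hv : v ≠ 0) : Function.Involutive (exchange v) := by
  intro x
  have := iplus_spec v
  unfold exchange
  grind

theorem exchange_neg {v : ℤ} (hv : v ≠ 0) (x : ℤ) : exchange v (-x) = -exchange v x := by
  have := iplus_spec v
  unfold exchange
  grind

theorem exchange_lt {v x y : ℤ} (hv : v ≠ 0) (hx : x ≠ 0) (hy : y ≠ 0) (hxy : x < y)
    (h₁ : ¬ (x = v ∧ y = iplus v)) (h₂ : ¬ (x = -iplus v ∧ y = -v)) :
    exchange v x < exchange v y := by
  have := iplus_spec v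
  unfold exchange
  grind

end Exchange

/-- Exchanging the consecutive values at an inverted pair `i < k` of `π` removes exactly this
inversion (and its mirror image). -/
theorem exists_remove_cover {n : ℕ} {π : SignedPerm n} {i k : ℤ} (hi : inPM n i) (hk : inPM n k)
    (hik : i < k) (hval : π.perm i = iplus (π.perm k)) :
    ∃ τ : SignedPerm n, τ.perm i < τ.perm k ∧
      (∀ a b, inPM n a → inPM n b → a < b → π.perm a < π.perm b → τ.perm a < τ.perm b) ∧
      (∀ a b, inPM n a → inPM n b → π.perm b < π.perm a → ¬ (a = i ∧ b = k) →
        ¬ (a = -k ∧ b = -i) → τ.perm b < τ.perm a) := by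
  have hi' := π.inPM_perm_iff.mpr hi
  have hk' := π.inPM_perm_iff.mpr hk
  have hv := hk'.1
  have hinj : ∀ {x y : ℤ}, π.perm x = π.perm y → x = y := fun h => π.perm.injective h
  refine ⟨⟨π.perm.trans (exchange_involutive hv).toPerm, fun x => ?_, fun x hx => ?_⟩, ?_, ?_, ?_⟩
  · simp [π.sign_symm, exchange_neg hv]
  · simp only [Equiv.trans_apply, Function.Involutive.coe_toPerm, π.outside x hx]
    unfold inPM at hi' hk'
    rw [lt_abs] at hx
    unfold exchange
    grind
  · simp only [Equiv.trans_apply, Function.Involutive.coe_toPerm, hval]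
    have := iplus_spec (π.perm k)
    unfold exchange
    grind
  · intro a b ha hb hab h
    refine exchange_lt hv (π.inPM_perm_iff.mpr ha).1 (π.inPM_perm_iff.mpr hb).1 h ?_ ?_
    · rintro ⟨h1, h2⟩
      have := hinj h1
      have := hinj (h2.trans hval.symm)
      omega
    · rw [← hval, ← π.sign_symm, ← π.sign_symm]
      rintro ⟨h1, h2⟩
      have := hinj h1
      have := hinj h2
      omega
  · intro a b ha hb h h1 h2
    refine exchange_lt hv (π.inPM_perm_iff.mpr hb).1 (π.inPM_perm_iff.mpr ha).1 h ?_ ?_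
    · rintro ⟨e1, e2⟩
      exact h1 ⟨hinj (e2.trans hval.symm), hinj e1⟩
    · rw [← hval, ← π.sign_symm, ← π.sign_symm]
      rintro ⟨e1, e2⟩
      exact h2 ⟨hinj e2, hinj e1⟩

/-- The inverted pairs of positions of `π`, among all integers of absolute value at most `n`. -/
noncomputable def invPairs {n : ℕ} (π : SignedPerm n) : Finset (ℤ × ℤ) :=
  (Finset.Icc (-(n : ℤ)) n ×ˢ Finset.Icc (-(n : ℤ)) n).filter
    fun p => p.1 < p.2 ∧ π.perm p.2 < π.perm p.1

theorem exists_isProjDagger {n : ℕ} {α : BComp n} (π : SignedPerm n) (hπ : memH α π) :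
    ∃ d, isProjDagger α π d := by
  induction hm : (invPairs π).card using Nat.strong_induction_on generalizing π with
  | _ m ih =>
  by_cases h : has312 α π
  · obtain ⟨i, j, k, hpat⟩ := exists_isPattern_of_has312 h
    obtain ⟨hi, -, hk, hij, hjk, -, hval, -⟩ := id hpat
    have hik := lt_of_blockIdx_lt α hi hk (hij.trans hjk)
    obtain ⟨τ, hτik, hτ₁, hτ₂⟩ := exists_remove_cover hi hk hik hval
    have hτπ : wle τ π := SignedPerm.wle_of_forall_inPM fun a b ha hb hab hinv => by
      by_contra! hc
      have hne : π.perm a ≠ π.perm b := fun e => hab.ne (π.perm.injective e)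
      exact hinv.not_gt (hτ₁ a b ha hb hab (lt_of_le_of_ne hc hne))
    have hστ : ∀ σ, mem312 α σ → wle σ π → wle σ τ := fun σ hσ hle => by
      have hnot := hpat.not_inverted_of_wle hσ hle
      rw [SignedPerm.wle_iff] at hle
      refine SignedPerm.wle_of_forall_inPM fun a b ha hb hab hinv =>
        hτ₂ a b ha hb (hle a b hab hinv) ?_ ?_
      · rintro ⟨rfl, rfl⟩
        exact hnot hinv
      · rintro ⟨rfl, rfl⟩
        rw [σ.sign_symm, σ.sign_symm] at hinv
        omega
    have hcard : (invPairs τ).card < m := by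
      rw [← hm]
      refine Finset.card_lt_card (Finset.ssubset_iff_of_subset ?_ |>.mpr ⟨(i, k), ?_, ?_⟩)
      · intro p hp
        rw [invPairs, Finset.mem_filter] at hp ⊢
        exact ⟨hp.1, hp.2.1, SignedPerm.wle_iff.mp hτπ _ _ hp.2.1 hp.2.2⟩
      · rw [invPairs, Finset.mem_filter, Finset.mem_product, Finset.mem_Icc, Finset.mem_Icc]
        have := iplus_spec (π.perm k)
        exact ⟨⟨hi.2, hk.2⟩, hik, by dsimp only; omega⟩
      · rw [invPairs, Finset.mem_filter]
        exact fun hp => hτik.not_gt hp.2.2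
    have hτH : memH α τ := fun a b ha hb hab hblock =>
      hτ₁ a b ha hb hab (hπ a b ha hb hab hblock)
    obtain ⟨d, hd, hdτ, hmax⟩ := ih _ hcard τ hτH rfl
    exact ⟨d, hd, hdτ.trans hτπ, fun σ hσ hle => hmax σ hσ (hστ σ hσ hle)⟩
  · exact ⟨π, ⟨hπ, h⟩, subset_rfl, fun _ _ h => h⟩

/-- For `π ∈ H_α`, the set `{σ ∈ H_α(312) : Inv σ ⊆ Inv π}`
has a (necessarily unique) greatest element with respect to inclusion of
inversion sets. -/
theorem projDagger_exists_unique (n : ℕ) (hn : 1 ≤ n) (α : BComp n)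
    (π : SignedPerm n) (hπ : memH α π) :
    ∃! d : SignedPerm n, isProjDagger α π d := by
  obtain ⟨d, hd⟩ := exists_isProjDagger π hπ
  exact ⟨d, hd, fun e he =>
    SignedPerm.wle_antisymm (hd.2.2 e he.1 he.2.1) (he.2.2 d hd.1 hd.2.1)⟩

end TypeB
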